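/- arXiv:2403.04828 — 2 statements merged into one kernel-verified Lean document; each statement's English description precedes it below -/
import Mathlib

section
/- Let ρ_{AB} be a subnormalized quantum state on ℂ^{d_A} ⊗ ℂ^{d_B} with ρ_B := tr_A(ρ_{AB}), let M be a set of POVM effects on ℂ^{d_A} ⊗ ℂ^{d_B} containing the identity, and let η ∈ (0, tr ρ_{AB}]. Define the complexity conditional entropy H_M^η(A|B)_ρ := −D_M^η(ρ_{AB} ‖ I_A ⊗ ρ_B). Then −log(d_A) ≤ H_M^η(A|B)_ρ ≤ log(d_A). Equivalently, 0 ≤ D_M^η(ρ_{AB} ‖ π_A ⊗ ρ_B) ≤ 2 log(d_A), where π_A := I_A/d_A. -/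
open Matrix
open scoped ComplexOrder Kronecker

noncomputable section

/-- A POVM effect: `0 ≤ Q ≤ I` in the Loewner order. -/
def IsEffect {ι : Type*} [Fintype ι] [DecidableEq ι] (Q : Matrix ι ι ℂ) : Prop :=
  Q.PosSemidef ∧ (1 - Q).PosSemidef

/-- Real part of the trace. -/
def trRe {ι : Type*} [Fintype ι] (A : Matrix ι ι ℂ) : ℝ := (A.trace).re

/-- Complexity relative entropy `D_M^η(ρ‖Γ) := −log( inf { tr(QΓ)/tr(Qρ) : Q ∈ M, tr(Qρ) ≥ η } )`,
valued in extended reals; the infimum over the empty set is `∞`, so `D = −∞` in that case. -/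
def Dc {ι : Type*} [Fintype ι] [DecidableEq ι] (M : Set (Matrix ι ι ℂ))
    (ρ Γ : Matrix ι ι ℂ) (η : ℝ) : EReal :=
  - ENNReal.log (⨅ Q ∈ {Q | Q ∈ M ∧ η ≤ trRe (Q * ρ)},
      ENNReal.ofReal (trRe (Q * Γ) / trRe (Q * ρ)))

/-- Partial trace over the first tensor factor:
`(tr_A X)_{b,b'} = Σ_a X_{(a,b),(a,b')}`. -/
def ptraceFst {dA dB : ℕ} (X : Matrix (Fin dA × Fin dB) (Fin dA × Fin dB) ℂ) :
    Matrix (Fin dB) (Fin dB) ℂ :=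
  Matrix.of fun b b' => ∑ a : Fin dA, X (a, b) (a, b')

/-- The complexity conditional entropy `H_M^η(A|B)_ρ := −D_M^η(ρ_{AB} ‖ I_A ⊗ ρ_B)`. -/
def HcondAB {dA dB : ℕ} (M : Set (Matrix (Fin dA × Fin dB) (Fin dA × Fin dB) ℂ))
    (ρ : Matrix (Fin dA × Fin dB) (Fin dA × Fin dB) ℂ) (η : ℝ) : EReal :=
  - Dc M ρ ((1 : Matrix (Fin dA) (Fin dA) ℂ) ⊗ₖ ptraceFst ρ) η

/-- The trace of a product of two positive-semidefinite matrices is nonnegative. -/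
lemma trRe_mul_nonneg {ι : Type*} [Fintype ι] [DecidableEq ι] {Q X : Matrix ι ι ℂ}
    (hQ : Q.PosSemidef) (hX : X.PosSemidef) : 0 ≤ trRe (Q * X) := by
  open scoped MatrixOrder in
  obtain ⟨B, rfl⟩ := CStarAlgebra.nonneg_iff_eq_star_mul_self.mp hX.nonneg
  have h := (hQ.mul_mul_conjTranspose_same B).trace_nonneg
  rw [Matrix.mul_assoc, Matrix.trace_mul_comm, Matrix.mul_assoc] at h
  exact (Complex.le_def.mp h).1

lemma trRe_sub {ι : Type*} [Fintype ι] (A B : Matrix ι ι ℂ) :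
    trRe (A - B) = trRe A - trRe B := by
  simp [trRe]

lemma trRe_ofReal_smul {ι : Type*} [Fintype ι] (r : ℝ) (A : Matrix ι ι ℂ) :
    trRe ((r : ℂ) • A) = r * trRe A := by
  simp [trRe]

lemma trRe_one_kronecker_ptraceFst {dA dB : ℕ}
    (X : Matrix (Fin dA × Fin dB) (Fin dA × Fin dB) ℂ) :
    trRe ((1 : Matrix (Fin dA) (Fin dA) ℂ) ⊗ₖ ptraceFst X) = dA * trRe X := by
  have h : (ptraceFst X).trace = X.trace := by
    simp only [Matrix.trace, Matrix.diag_apply, ptraceFst, Matrix.of_apply,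
      Fintype.sum_prod_type]
    exact Finset.sum_comm
  simp [trRe, Matrix.trace_kronecker, h]

/-- Pinching in the first tensor factor satisfies `X ≤ d_A · ∑ a, P_a X P_a`. -/
lemma posSemidef_smul_pinching_sub {dA dB : ℕ}
    {X : Matrix (Fin dA × Fin dB) (Fin dA × Fin dB) ℂ} (hX : X.PosSemidef) :
    ((dA : ℂ) • Matrix.of (fun i j => if i.1 = j.1 then X i j else 0) - X).PosSemidef := by
  let D : Fin dA → Fin dA → Matrix (Fin dA × Fin dB) (Fin dA × Fin dB) ℂ := fun a a' =>
    Matrix.diagonal fun i => (if i.1 = a then 1 else 0) - (if i.1 = a' then 1 else 0)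
  have hD : ∀ a a', (D a a')ᴴ = D a a' := by
    intro a a'
    simp only [D, Matrix.diagonal_conjTranspose]
    congr 1
    ext i
    simp only [Pi.star_apply]
    split_ifs <;> simp
  have h : (∑ a, ∑ a', D a a' * X * (D a a')ᴴ).PosSemidef :=
    Matrix.posSemidef_sum _ fun a _ => Matrix.posSemidef_sum _ fun a' _ =>
      hX.mul_mul_conjTranspose_same _
  have h2 := h.smul (show (0 : ℝ) ≤ 1 / 2 by norm_num)
  convert h2 using 1
  ext i j
  simp only [hD]
  simp only [D, Matrix.sub_apply, Matrix.smul_apply, Matrix.of_apply, Matrix.sum_apply,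
    Matrix.mul_diagonal, Matrix.diagonal_mul, smul_eq_mul]
  have e : ∀ a a' : Fin dA,
      ((if i.1 = a then (1 : ℂ) else 0) - (if i.1 = a' then 1 else 0)) * X i j *
        ((if j.1 = a then 1 else 0) - (if j.1 = a' then 1 else 0)) =
      (if i.1 = a then if j.1 = a then X i j else 0 else 0)
        + (if i.1 = a' then if j.1 = a' then X i j else 0 else 0)
        - (if i.1 = a then if j.1 = a' then X i j else 0 else 0)
        - (if i.1 = a' then if j.1 = a then X i j else 0 else 0) := by
    intro a a'
    split_ifs <;> ring
  simp only [e, Finset.sum_add_distrib, Finset.sum_sub_distrib, Finset.sum_ite_eq,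
    Finset.mem_univ, if_true, Finset.sum_const, Finset.card_univ, Fintype.card_fin]
  by_cases hij : i.1 = j.1
  · simp [hij]
    ring
  · have e₁ : ∀ a, (if i.1 = a then if j.1 = a then X i j else 0 else 0) = 0 := by
      grind
    simp [hij, mt Eq.symm hij, e₁]
    ring

/-- Pinching in the first tensor factor is dominated by `1 ⊗ tr_A X`. -/
lemma posSemidef_one_kronecker_ptraceFst_sub_pinching {dA dB : ℕ}
    {X : Matrix (Fin dA × Fin dB) (Fin dA × Fin dB) ℂ} (hX : X.PosSemidef) :
    ((1 : Matrix (Fin dA) (Fin dA) ℂ) ⊗ₖ ptraceFst X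
      - Matrix.of (fun i j => if i.1 = j.1 then X i j else 0)).PosSemidef := by
  let D : Fin dA → Matrix (Fin dA × Fin dB) (Fin dA × Fin dB) ℂ := fun a =>
    Matrix.diagonal fun i => if i.1 = a then 1 else 0
  have hD : ∀ a, (D a)ᴴ = D a := by
    intro a
    simp only [D, Matrix.diagonal_conjTranspose]
    congr 1
    ext i
    simp [apply_ite]
  have h : (∑ a, ∑ a' ∈ Finset.univ.erase a,
      D a * X.submatrix (fun i : Fin dA × Fin dB => (a', i.2))
        (fun i : Fin dA × Fin dB => (a', i.2)) * (D a)ᴴ).PosSemidef :=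
    Matrix.posSemidef_sum _ fun a _ => Matrix.posSemidef_sum _ fun a' _ =>
      (hX.submatrix _).mul_mul_conjTranspose_same _
  convert h using 1
  ext ⟨a, b⟩ ⟨a', b'⟩
  simp only [hD]
  simp only [D, Matrix.sub_apply, Matrix.of_apply, Matrix.sum_apply, Matrix.kroneckerMap_apply,
    Matrix.mul_diagonal, Matrix.diagonal_mul, Matrix.submatrix_apply, ptraceFst,
    Matrix.one_apply, ← Finset.sum_mul, ← Finset.mul_sum, ite_mul, one_mul, zero_mul,
    Finset.sum_ite_eq, Finset.mem_univ, if_true]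
  by_cases hab : a = a'
  · subst hab
    simp [Finset.sum_erase_eq_sub]
  · simp [hab, Ne.symm hab]

/-- The operator inequality `X ≤ d_A · (1 ⊗ tr_A X)`. -/
lemma posSemidef_smul_one_kronecker_ptraceFst_sub {dA dB : ℕ}
    {X : Matrix (Fin dA × Fin dB) (Fin dA × Fin dB) ℂ} (hX : X.PosSemidef) :
    ((dA : ℂ) • ((1 : Matrix (Fin dA) (Fin dA) ℂ) ⊗ₖ ptraceFst X) - X).PosSemidef := by
  have h := ((posSemidef_one_kronecker_ptraceFst_sub_pinching hX).smul
    (show (0 : ℂ) ≤ dA by exact_mod_cast dA.zero_le)).add (posSemidef_smul_pinching_sub hX)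
  rwa [smul_sub, sub_add_sub_cancel] at h

/-- Bounds on the complexity relative entropy: below from the test `Q = 1`, above from
a uniform bound on the ratios. -/
lemma Dc_bounds {ι : Type*} [Fintype ι] [DecidableEq ι] {M : Set (Matrix ι ι ℂ)}
    (hI : 1 ∈ M) {ρ Γ : Matrix ι ι ℂ} {η c C : ℝ} (hη : 0 < η) (hη' : η ≤ trRe ρ)
    (hc : 0 < c) (hC : 0 < C) (hΓ : trRe Γ = C * trRe ρ)
    (h : ∀ Q ∈ M, c * trRe (Q * ρ) ≤ trRe (Q * Γ)) :
    ((-Real.log C : ℝ) : EReal) ≤ Dc M ρ Γ η ∧ Dc M ρ Γ η ≤ ((-Real.log c : ℝ) : EReal) := by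
  unfold Dc
  rw [EReal.coe_neg, EReal.coe_neg, EReal.neg_le_neg_iff, EReal.neg_le_neg_iff,
    ← ENNReal.log_ofReal_of_pos hc, ← ENNReal.log_ofReal_of_pos hC]
  constructor
  · refine ENNReal.log_monotone ((iInf₂_le 1 ⟨hI, by simpa using hη'⟩).trans ?_)
    rw [Matrix.one_mul, Matrix.one_mul, hΓ, mul_div_cancel_right₀ _ (hη.trans_le hη').ne']
  · refine ENNReal.log_monotone (le_iInf₂ fun Q hQ => ENNReal.ofReal_le_ofReal ?_)
    rw [le_div_iff₀ (hη.trans_le hQ.2)]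
    exact h Q hQ.1

/-- General bounds for the complexity conditional entropy:
`−log d_A ≤ H_M^η(A|B)_ρ ≤ log d_A`; equivalently,
`0 ≤ D_M^η(ρ_{AB} ‖ π_A ⊗ ρ_B) ≤ 2 log d_A` with `π_A := I_A/d_A`. -/
theorem stmt11 {dA dB : ℕ}
    (M : Set (Matrix (Fin dA × Fin dB) (Fin dA × Fin dB) ℂ))
    (hM : ∀ Q ∈ M, IsEffect Q)
    (hI : (1 : Matrix (Fin dA × Fin dB) (Fin dA × Fin dB) ℂ) ∈ M)
    (ρ : Matrix (Fin dA × Fin dB) (Fin dA × Fin dB) ℂ)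
    (hρ : ρ.PosSemidef) (hρtr : trRe ρ ≤ 1)
    (η : ℝ) (hη : 0 < η) (hη' : η ≤ trRe ρ) :
    (((-Real.log dA : ℝ) : EReal) ≤ HcondAB M ρ η ∧
      HcondAB M ρ η ≤ ((Real.log dA : ℝ) : EReal)) ∧
    ((0 : EReal) ≤ Dc M ρ ((((dA : ℂ))⁻¹ • (1 : Matrix (Fin dA) (Fin dA) ℂ)) ⊗ₖ ptraceFst ρ) η ∧
      Dc M ρ ((((dA : ℂ))⁻¹ • (1 : Matrix (Fin dA) (Fin dA) ℂ)) ⊗ₖ ptraceFst ρ) η ≤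
        ((2 * Real.log dA : ℝ) : EReal)) := by
  have hd : 0 < (dA : ℝ) := by
    rcases Nat.eq_zero_or_pos dA with rfl | h
    · have : trRe ρ = 0 := by simp [trRe, Matrix.trace]
      linarith
    · exact_mod_cast h
  set Γ := (1 : Matrix (Fin dA) (Fin dA) ℂ) ⊗ₖ ptraceFst ρ with hΓ
  have htr : trRe Γ = dA * trRe ρ := trRe_one_kronecker_ptraceFst ρ
  have hle : ∀ Q ∈ M, trRe (Q * ρ) ≤ dA * trRe (Q * Γ) := by
    intro Q hQ
    have h := trRe_mul_nonneg (hM Q hQ).1 (posSemidef_smul_one_kronecker_ptraceFst_sub hρ)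
    rw [Matrix.mul_sub, trRe_sub, Matrix.mul_smul, ← Complex.ofReal_natCast,
      trRe_ofReal_smul] at h
    linarith
  have hπ : ((dA : ℂ)⁻¹ • (1 : Matrix (Fin dA) (Fin dA) ℂ)) ⊗ₖ ptraceFst ρ
      = (((dA : ℝ)⁻¹ : ℝ) : ℂ) • Γ := by
    rw [Matrix.smul_kronecker, hΓ]
    norm_num
  constructor
  · obtain ⟨h₁, h₂⟩ := Dc_bounds (c := (dA : ℝ)⁻¹) hI hη hη' (inv_pos.mpr hd) hd htr
      fun Q hQ => (inv_mul_le_iff₀ hd).mpr (hle Q hQ)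
    rw [Real.log_inv, neg_neg] at h₂
    unfold HcondAB
    constructor
    · rw [EReal.coe_neg]
      exact EReal.neg_le_neg_iff.mpr h₂
    · rw [EReal.coe_neg] at h₁
      exact EReal.neg_le_of_neg_le h₁
  · rw [hπ]
    obtain ⟨h₁, h₂⟩ := Dc_bounds (Γ := (((dA : ℝ)⁻¹ : ℝ) : ℂ) • Γ) (c := ((dA : ℝ) ^ 2)⁻¹)
      (C := 1) hI hη hη' (by positivity) one_pos
      (by rw [trRe_ofReal_smul, htr, inv_mul_cancel_left₀ hd.ne', one_mul])
      fun Q hQ => by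
        rw [Matrix.mul_smul, trRe_ofReal_smul, sq, mul_inv, mul_assoc]
        exact mul_le_mul_of_nonneg_left ((inv_mul_le_iff₀ hd).mpr (hle Q hQ)) (by positivity)
    rw [Real.log_inv, neg_neg, Real.log_pow] at h₂
    rw [Real.log_one, neg_zero] at h₁
    exact ⟨by exact_mod_cast h₁, by exact_mod_cast h₂⟩

end
end

section
/- Consider n qubits with Hilbert space (ℂ²)^{⊗n}. Let G be a set of unitaries on (ℂ²)^{⊗n}. For W ⊆ {1,…,n} let P_W denote the POVM effect acting as the identity on each qubit in W and as |0⟩⟨0| on each qubit outside W. For an integer r ≥ 0, let M_r := { U† P_W U : W ⊆ {1,…,n}, U a product of at most r elements of G }. Let ρ be a quantum state on (ℂ²)^{⊗n} and η ∈ (0,1], and define the optimal reset number w_r* := min { |W| : W ⊆ {1,…,n}, ∃ U a product of at most r elements of G with tr(P_W · U ρ U†) ≥ η } (the number of single-qubit \textsc{reset} operations used by an optimal erasure protocol that applies a circuit of at most r gates from G and then resets the qubits in W; tr(P_W U ρ U†) is the squared fidelity of the protocol's output with |0ⁿ⟩). Then H_{M_r}^η(ρ) − log(1/η) ≤ w_r*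 · log 2 ≤ H_{M_r}^η(ρ). -/
open Matrix
open scoped ComplexOrder

noncomputable section

/-- Complexity entropy `H_M^η(ρ) := log( inf { tr(Q)/tr(Qρ) : Q ∈ M, tr(Qρ) ≥ η } )`,
valued in extended reals; the infimum over the empty set is `∞`. -/
def Hc {ι : Type*} [Fintype ι] [DecidableEq ι] (M : Set (Matrix ι ι ℂ))
    (ρ : Matrix ι ι ℂ) (η : ℝ) : EReal :=
  ENNReal.log (⨅ Q ∈ {Q | Q ∈ M ∧ η ≤ trRe (Q * ρ)},
      ENNReal.ofReal (trRe (Q * 1) / trRe (Q * ρ)))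

variable {n : ℕ}

/-- The POVM effect acting as the identity on each qubit in `W` and as `|0⟩⟨0|` on each qubit
outside `W`. -/
def Pw (W : Finset (Fin n)) : Matrix (Fin n → Fin 2) (Fin n → Fin 2) ℂ :=
  Matrix.of fun x y => ∏ i : Fin n,
    if i ∈ W then (if x i = y i then (1 : ℂ) else 0)
    else (if x i = 0 ∧ y i = 0 then 1 else 0)

/-- `V` is a product of at most `r` elements of `G` (the empty product being the identity). -/
def IsProdOfAtMost (G : Set (Matrix (Fin n → Fin 2) (Fin n → Fin 2) ℂ)) (r : ℕ)
    (V : Matrix (Fin n → Fin 2) (Fin n → Fin 2) ℂ) : Prop :=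
  ∃ L : List (Matrix (Fin n → Fin 2) (Fin n → Fin 2) ℂ),
    L.length ≤ r ∧ (∀ A ∈ L, A ∈ G) ∧ V = L.prod

/-- `M_r := { U† P_W U : W ⊆ {1,…,n}, U a product of at most r elements of G }`. -/
def Mset (G : Set (Matrix (Fin n → Fin 2) (Fin n → Fin 2) ℂ)) (r : ℕ) :
    Set (Matrix (Fin n → Fin 2) (Fin n → Fin 2) ℂ) :=
  { Q | ∃ W : Finset (Fin n), ∃ U, IsProdOfAtMost G r U ∧ Q = Uᴴ * Pw W * U }

lemma Pw_eq_diagonal (W : Finset (Fin n)) :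
    Pw W = Matrix.diagonal fun x => ∏ i : Fin n, if i ∈ W ∨ x i = 0 then (1 : ℂ) else 0 := by
  ext x y
  by_cases hxy : x = y
  · subst hxy
    simp only [Pw, Matrix.of_apply, Matrix.diagonal_apply_eq]
    refine Finset.prod_congr rfl fun i _ => ?_
    by_cases hi : i ∈ W <;> simp [hi]
  · rw [Matrix.diagonal_apply_ne _ hxy]
    obtain ⟨i, hi⟩ := Function.ne_iff.mp hxy
    refine Finset.prod_eq_zero (Finset.mem_univ i) ?_
    by_cases hW : i ∈ W
    · simp [hW, hi]
    · have : ¬ (x i = 0 ∧ y i = 0) := fun h => hi (h.1.trans h.2.symm)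
      simp [hW, this]

lemma trace_Pw (W : Finset (Fin n)) : (Pw W).trace = 2 ^ W.card := by
  rw [Pw_eq_diagonal, Matrix.trace_diagonal,
    ← Fintype.prod_sum fun (i : Fin n) (b : Fin 2) => if i ∈ W ∨ b = 0 then (1 : ℂ) else 0]
  have h : ∀ i : Fin n, (∑ b : Fin 2, if i ∈ W ∨ b = 0 then (1 : ℂ) else 0) =
      if i ∈ W then 2 else 1 := by
    intro i
    by_cases hi : i ∈ W <;> simp [hi]
  simp [h]

lemma trRe_Pw_mul_le (W : Finset (Fin n)) {A : Matrix (Fin n → Fin 2) (Fin n → Fin 2) ℂ}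
    (hA : A.PosSemidef) : trRe (Pw W * A) ≤ trRe A := by
  simp only [trRe, Matrix.trace, Matrix.diag_apply, Complex.re_sum]
  refine Finset.sum_le_sum fun x _ => ?_
  rw [Pw_eq_diagonal, Matrix.diagonal_mul]
  have hx : 0 ≤ (A x x).re := (Complex.le_def.mp hA.diag_nonneg).1
  by_cases h : ∀ i, i ∈ W ∨ x i = 0
  · simp [h]
  · push Not at h
    obtain ⟨i, hi⟩ := h
    rw [Finset.prod_eq_zero (Finset.mem_univ i) (by simp [hi])]
    simpa using hx

lemma IsProdOfAtMost.mem_unitaryGroup {G : Set (Matrix (Fin n → Fin 2) (Fin n → Fin 2) ℂ)}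
    (hG : ∀ A ∈ G, A ∈ Matrix.unitaryGroup (Fin n → Fin 2) ℂ) {r : ℕ}
    {U : Matrix (Fin n → Fin 2) (Fin n → Fin 2) ℂ} (hU : IsProdOfAtMost G r U) :
    U ∈ Matrix.unitaryGroup (Fin n → Fin 2) ℂ := by
  obtain ⟨L, -, hL, rfl⟩ := hU
  exact list_prod_mem fun A hA => hG A (hL A hA)

lemma trRe_conj_mul {ι : Type*} [Fintype ι] (U P ρ : Matrix ι ι ℂ) :
    trRe (Uᴴ * P * U * ρ) = trRe (P * (U * ρ * Uᴴ)) := by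
  simp only [trRe]
  rw [Matrix.mul_assoc, Matrix.mul_assoc, Matrix.trace_mul_comm]
  simp only [Matrix.mul_assoc]

lemma trRe_conj_unitary {ι : Type*} [Fintype ι] [DecidableEq ι] {U : Matrix ι ι ℂ}
    (hU : U ∈ Matrix.unitaryGroup ι ℂ) (A : Matrix ι ι ℂ) :
    trRe (U * A * Uᴴ) = trRe A := by
  have h : Uᴴ * U = 1 := Matrix.mem_unitaryGroup_iff'.mp hU
  rw [trRe, Matrix.trace_mul_comm, ← Matrix.mul_assoc, h, Matrix.one_mul, trRe]

lemma trRe_conj_Pw {U : Matrix (Fin n → Fin 2) (Fin n → Fin 2) ℂ}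
    (hU : U ∈ Matrix.unitaryGroup (Fin n → Fin 2) ℂ) (W : Finset (Fin n)) :
    trRe (Uᴴ * Pw W * U * 1) = 2 ^ W.card := by
  have h : U * Uᴴ = 1 := Matrix.mem_unitaryGroup_iff.mp hU
  rw [trRe_conj_mul, Matrix.mul_one, h, Matrix.mul_one, trRe, trace_Pw]
  norm_cast

lemma ENNReal.log_ofReal_two_pow_div (w : ℕ) {c : ℝ} (hc : 0 < c) :
    ENNReal.log (ENNReal.ofReal (2 ^ w / c)) =
      ((w * Real.log 2 + Real.log (1 / c) : ℝ) : EReal) := by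
  have h : (0 : ℝ) < 2 ^ w / c := by positivity
  rw [ENNReal.log_ofReal_of_pos h, div_eq_mul_one_div,
    Real.log_mul (by positivity) (by positivity), Real.log_pow]

/-- Complexity-limited erasure with restricted protocols: the optimal number
`w_r*` of single-qubit resets, for an erasure protocol consisting of at most `r` gates from `G`
followed by resets of the qubits in `W`, satisfies
`H_{M_r}^η(ρ) − log(1/η) ≤ w_r*·log 2 ≤ H_{M_r}^η(ρ)`. -/
theorem stmt13 (G : Set (Matrix (Fin n → Fin 2) (Fin n → Fin 2) ℂ))
    (hG : ∀ A ∈ G, A ∈ Matrix.unitaryGroup (Fin n → Fin 2) ℂ)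
    (ρ : Matrix (Fin n → Fin 2) (Fin n → Fin 2) ℂ)
    (hρ : ρ.PosSemidef) (hρtr : ρ.trace = 1)
    (η : ℝ) (hη : η ∈ Set.Ioc (0:ℝ) 1) (r : ℕ) :
    Hc (Mset G r) ρ η - ((Real.log (1 / η) : ℝ) : EReal) ≤
      (((sInf {w : ℕ | ∃ W : Finset (Fin n), W.card = w ∧
          ∃ U, IsProdOfAtMost G r U ∧ η ≤ trRe (Pw W * (U * ρ * Uᴴ))} : ℕ) : ℝ)
        * Real.log 2 : ℝ) ∧
    ((((sInf {w : ℕ | ∃ W : Finset (Fin n), W.card = w ∧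
          ∃ U, IsProdOfAtMost G r U ∧ η ≤ trRe (Pw W * (U * ρ * Uᴴ))} : ℕ) : ℝ)
        * Real.log 2 : ℝ) : EReal) ≤ Hc (Mset G r) ρ η := by
  have hη0 : 0 < η := hη.1
  set S := {w : ℕ | ∃ W : Finset (Fin n), W.card = w ∧
    ∃ U, IsProdOfAtMost G r U ∧ η ≤ trRe (Pw W * (U * ρ * Uᴴ))}
  have hne : S.Nonempty := by
    refine ⟨_, Finset.univ, rfl, 1, ⟨[], by simp, by simp, by simp⟩, ?_⟩
    have : Pw (Finset.univ : Finset (Fin n)) = 1 := by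
      simp [Pw_eq_diagonal]
    simpa [this, trRe, hρtr] using hη.2
  constructor
  · obtain ⟨W, hW, U, hU, hle⟩ := Nat.sInf_mem hne
    have hUu := hU.mem_unitaryGroup hG
    refine EReal.sub_le_of_le_add ?_
    rw [← EReal.coe_add, ← ENNReal.log_ofReal_two_pow_div _ hη0]
    refine ENNReal.log_monotone (iInf₂_le_of_le (Uᴴ * Pw W * U)
      ⟨⟨W, U, hU, rfl⟩, by rwa [trRe_conj_mul]⟩ (ENNReal.ofReal_le_ofReal ?_))
    rw [trRe_conj_Pw hUu, trRe_conj_mul, hW]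
    gcongr
  · have h := ENNReal.log_ofReal_two_pow_div (sInf S) one_pos
    rw [div_one, div_one, Real.log_one, add_zero] at h
    rw [← h]
    refine ENNReal.log_monotone (le_iInf₂ ?_)
    rintro Q ⟨⟨W, U, hU, rfl⟩, hle⟩
    have hUu := hU.mem_unitaryGroup hG
    refine ENNReal.ofReal_le_ofReal ?_
    rw [trRe_conj_mul] at hle
    rw [trRe_conj_Pw hUu, trRe_conj_mul]
    have hp1 : trRe (Pw W * (U * ρ * Uᴴ)) ≤ 1 := by
      refine (trRe_Pw_mul_le W (hρ.mul_mul_conjTranspose_same U)).trans ?_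
      rw [trRe_conj_unitary hUu, trRe, hρtr, Complex.one_re]
    calc (2 : ℝ) ^ sInf S ≤ 2 ^ W.card :=
          pow_le_pow_right₀ one_le_two (Nat.sInf_le ⟨W, rfl, U, hU, hle⟩)
      _ ≤ _ := le_div_self (by positivity) (hη0.trans_le hle) hp1

end
end
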